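/- The torsion of the Γ-linear connection ∇ satisfies, for all i, j: T(∂/∂y^j, δ/δx^i) = Σ_r C^r_{ij} · δ/δx^r + Σ_r (∂N^r_i/∂y^j − Lv^r_{ji}) · ∂/∂y^r, and T(∂/∂y^j, ∂/∂y^i) = Σ_r (Cv^r_{ij} − Cv^r_{ji}) · ∂/∂y^r. -/

import Mathlib

noncomputable section
open scoped BigOperators

/-- The local model `E = ℝ × (Fin n → ℝ) × (Fin n → ℝ)` of the 1-jet space `J¹(ℝ,M)`,
with coordinates `(t, x, y)`. -/
abbrev E (n : ℕ) : Type := ℝ × (Fin n → ℝ) × (Fin n → ℝ)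

variable {n : ℕ}

/-- Partial derivative `∂f/∂t`. -/
def pT (f : E n → ℝ) (p : E n) : ℝ := fderiv ℝ f p (1, 0, 0)

/-- Partial derivative `∂f/∂x^i`. -/
def pX (f : E n → ℝ) (i : Fin n) (p : E n) : ℝ := fderiv ℝ f p (0, Pi.single i 1, 0)

/-- Partial derivative `∂f/∂y^i`. -/
def pY (f : E n → ℝ) (i : Fin n) (p : E n) : ℝ := fderiv ℝ f p (0, 0, Pi.single i 1)

/-- The adapted temporal frame field `δ/δt = ∂/∂t - Σ_j M^j ∂/∂y^j`. -/
def delT (M : E n → Fin n → ℝ) (p : E n) : E n := (1, 0, fun j => -(M p j))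

/-- The adapted spatial frame field `δ/δx^i = ∂/∂x^i - Σ_j N^j_i ∂/∂y^j`. -/
def delX (N : E n → Fin n → Fin n → ℝ) (i : Fin n) (p : E n) : E n :=
  (0, Pi.single i 1, fun j => -(N p i j))

/-- The vertical frame field `∂/∂y^i`. -/
def delY (i : Fin n) (p : E n) : E n := ((0 : ℝ), (0 : Fin n → ℝ), Pi.single i 1)

/-- The Lie bracket `[X,Y](p) = (DY)(p)(X(p)) - (DX)(p)(Y(p))` of vector fields on `E`. -/
def lieBr (X Y : E n → E n) (p : E n) : E n := fderiv ℝ Y p (X p) - fderiv ℝ X p (Y p)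

/-- `δf/δt := ∂f/∂t - Σ_k M^k ∂f/∂y^k`. -/
def dT (M : E n → Fin n → ℝ) (f : E n → ℝ) (p : E n) : ℝ :=
  pT f p - ∑ k, M p k * pY f k p

/-- `δf/δx^i := ∂f/∂x^i - Σ_k N^k_i ∂f/∂y^k`. -/
def dX (N : E n → Fin n → Fin n → ℝ) (f : E n → ℝ) (i : Fin n) (p : E n) : ℝ :=
  pX f i p - ∑ k, N p i k * pY f k p

/-- A d-vector field `X = a·δ/δt + Σ_i b^i·δ/δx^i + Σ_i c^i·∂/∂y^i`
given by its adapted components. -/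
structure DVF (n : ℕ) where
  a : E n → ℝ
  b : E n → Fin n → ℝ
  c : E n → Fin n → ℝ

/-- The actual vector field on `E` determined by the adapted components of a `DVF`. -/
def DVF.realize (M : E n → Fin n → ℝ) (N : E n → Fin n → Fin n → ℝ) (X : DVF n)
    (p : E n) : E n :=
  (X.a p, X.b p, fun j => X.c p j - X.a p * M p j - ∑ i, X.b p i * N p i j)

/-- The nine families of adapted coefficients of a Γ-linear connection `∇`:
`Ḡ¹₁₁, G^k_{i1}, G^{(k)(1)}_{(1)(i)1}, L̄¹_{1j}, L^k_{ij}, L^{(k)(1)}_{(1)(i)j},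
C̄^{1(1)}_{1(j)}, C^{k(1)}_{i(j)}, C^{(k)(1)(1)}_{(1)(i)(j)}`. -/
structure Conn (n : ℕ) where
  Gbar : E n → ℝ
  G : E n → Fin n → Fin n → ℝ
  Gv : E n → Fin n → Fin n → ℝ
  Lbar : E n → Fin n → ℝ
  L : E n → Fin n → Fin n → Fin n → ℝ
  Lv : E n → Fin n → Fin n → Fin n → ℝ
  Cbar : E n → Fin n → ℝ
  C : E n → Fin n → Fin n → Fin n → ℝ
  Cv : E n → Fin n → Fin n → Fin n → ℝ

/-- All nine coefficient families are smooth. -/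
def Conn.Smooth (K : Conn n) : Prop :=
  ContDiff ℝ (⊤ : ℕ∞) K.Gbar ∧ ContDiff ℝ (⊤ : ℕ∞) K.G ∧ ContDiff ℝ (⊤ : ℕ∞) K.Gv ∧ ContDiff ℝ (⊤ : ℕ∞) K.Lbar ∧
  ContDiff ℝ (⊤ : ℕ∞) K.L ∧ ContDiff ℝ (⊤ : ℕ∞) K.Lv ∧ ContDiff ℝ (⊤ : ℕ∞) K.Cbar ∧ ContDiff ℝ (⊤ : ℕ∞) K.C ∧
  ContDiff ℝ (⊤ : ℕ∞) K.Cv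

/-- Derivative `X(f)(p) := Df(p)(X(p))` of `f` along the realized vector field of `X`. -/
def Xder (M : E n → Fin n → ℝ) (N : E n → Fin n → Fin n → ℝ) (X : DVF n) (f : E n → ℝ)
    (p : E n) : ℝ := fderiv ℝ f p (X.realize M N p)

/-- The Γ-linear connection `∇_X W` in adapted components. -/
def nabla (M : E n → Fin n → ℝ) (N : E n → Fin n → Fin n → ℝ) (K : Conn n)
    (X W : DVF n) : DVF n where
  a := fun p => Xder M N X W.a p +
    W.a p * (X.a p * K.Gbar p + ∑ j, X.b p j * K.Lbar p j + ∑ j, X.c p j * K.Cbar p j)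
  b := fun p k => Xder M N X (fun q => W.b q k) p +
    ∑ i, W.b p i *
      (X.a p * K.G p k i + ∑ j, X.b p j * K.L p k i j + ∑ j, X.c p j * K.C p k i j)
  c := fun p k => Xder M N X (fun q => W.c q k) p +
    ∑ i, W.c p i *
      (X.a p * K.Gv p k i + ∑ j, X.b p j * K.Lv p k i j + ∑ j, X.c p j * K.Cv p k i j)

/-- The adapted frame field `δ/δt` as a `DVF`. -/
def frT : DVF n := ⟨fun _ => 1, fun _ => 0, fun _ => 0⟩

/-- The adapted frame field `δ/δx^i` as a `DVF`. -/
def frX (i : Fin n) : DVF n := ⟨fun _ => 0, fun _ => Pi.single i 1, fun _ => 0⟩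

/-- The adapted frame field `∂/∂y^i` as a `DVF`. -/
def frY (i : Fin n) : DVF n := ⟨fun _ => 0, fun _ => 0, fun _ => Pi.single i 1⟩

/-- Decomposition of an arbitrary vector field into adapted components. -/
def decomp (M : E n → Fin n → ℝ) (N : E n → Fin n → Fin n → ℝ) (V : E n → E n) : DVF n :=
  ⟨fun p => (V p).1, fun p => (V p).2.1,
   fun p j => (V p).2.2 j + (V p).1 * M p j + ∑ i, (V p).2.1 i * N p i j⟩

/-- The torsion `T(X,Y) := ∇_X Y - ∇_Y X - [X,Y]`. -/
def torsion (M : E n → Fin n → ℝ) (N : E n → Fin n → Fin n → ℝ) (K : Conn n)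
    (X Y : DVF n) (p : E n) : E n :=
  (nabla M N K X Y).realize M N p - (nabla M N K Y X).realize M N p -
    lieBr (X.realize M N) (Y.realize M N) p

/-- The curvature `R(X,Y)Z := ∇_X(∇_Y Z) - ∇_Y(∇_X Z) - ∇_{[X,Y]}Z`. -/
def curv (M : E n → Fin n → ℝ) (N : E n → Fin n → Fin n → ℝ) (K : Conn n)
    (X Y Z : DVF n) (p : E n) : E n :=
  (nabla M N K X (nabla M N K Y Z)).realize M N p -
    (nabla M N K Y (nabla M N K X Z)).realize M N p -
    (nabla M N K (decomp M N (lieBr (X.realize M N) (Y.realize M N))) Z).realize M N p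

/-- The realization of the frame component `frX i` is the frame field `δ/δx^i`. -/
lemma realize_frX (M : E n → Fin n → ℝ) (N : E n → Fin n → Fin n → ℝ) (i : Fin n) :
    (frX i).realize M N = delX N i := by
  funext p
  simp [DVF.realize, frX, delX, Pi.single_apply]

/-- The realization of the frame component `frY i` is the frame field `∂/∂y^i`. -/
lemma realize_frY (M : E n → Fin n → ℝ) (N : E n → Fin n → Fin n → ℝ) (i : Fin n) :
    (frY i).realize M N = delY i := by
  funext p
  simp [DVF.realize, frY, delY]

lemma nabla_frY_frX (M : E n → Fin n → ℝ) (N : E n → Fin n → Fin n → ℝ) (K : Conn n)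
    (i j : Fin n) :
    nabla M N K (frY j) (frX i) = ⟨fun _ => 0, fun p k => K.C p k i j, fun _ _ => 0⟩ := by
  simp [nabla, frX, frY, Xder, Pi.single_apply]

lemma nabla_frX_frY (M : E n → Fin n → ℝ) (N : E n → Fin n → Fin n → ℝ) (K : Conn n)
    (i j : Fin n) :
    nabla M N K (frX i) (frY j) = ⟨fun _ => 0, fun _ _ => 0, fun p k => K.Lv p k j i⟩ := by
  simp [nabla, frX, frY, Xder, Pi.single_apply]

lemma nabla_frY_frY (M : E n → Fin n → ℝ) (N : E n → Fin n → Fin n → ℝ) (K : Conn n)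
    (i j : Fin n) :
    nabla M N K (frY j) (frY i) = ⟨fun _ => 0, fun _ _ => 0, fun p k => K.Cv p k i j⟩ := by
  simp [nabla, frY, Xder, Pi.single_apply]

lemma fderiv_delY (i : Fin n) (p : E n) : fderiv ℝ (delY i : E n → E n) p = 0 :=
  fderiv_const_apply (𝕜 := ℝ) (x := p) ((0, 0, Pi.single i 1) : E n)

lemma fderiv_delX_apply {N : E n → Fin n → Fin n → ℝ} (hN : Differentiable ℝ N) (i : Fin n)
    (p v : E n) :
    fderiv ℝ (delX N i) p v = (0, 0, fun k => -(fderiv ℝ (fun q => N q i k) p v)) := by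
  have hcomp : ∀ k, HasFDerivAt (fun q => -(N q i k)) (-(fderiv ℝ (fun q => N q i k) p)) p :=
    fun k => (DifferentiableAt.hasFDerivAt (by fun_prop)).neg
  have h : HasFDerivAt (delX N i) _ p :=
    (hasFDerivAt_const (0 : ℝ) p).prodMk
      ((hasFDerivAt_const (Pi.single i 1 : Fin n → ℝ) p).prodMk (hasFDerivAt_pi.2 hcomp))
  rw [h.fderiv]
  rfl

/-- `[∂/∂y^j, δ/δx^i] = -Σ_k (∂N^k_i/∂y^j)·∂/∂y^k`. -/
lemma lieBr_delY_delX {N : E n → Fin n → Fin n → ℝ} (hN : Differentiable ℝ N) (i j : Fin n)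
    (p : E n) :
    lieBr (delY j) (delX N i) p = (0, 0, fun k => -(pY (fun q => N q i k) j p)) := by
  simp [lieBr, fderiv_delY, fderiv_delX_apply hN, pY, delY]

lemma lieBr_delY_delY (i j : Fin n) (p : E n) : lieBr (delY j) (delY i) p = 0 := by
  simp [lieBr, fderiv_delY]

lemma sum_smul_delY (c : Fin n → ℝ) (p : E n) : ∑ r, c r • delY r p = (0, 0, c) := by
  refine Prod.ext ?_ (Prod.ext ?_ ?_)
  · simp [delY, Prod.fst_sum]
  · simp [delY, Prod.fst_sum, Prod.snd_sum]
  · funext k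
    simp [delY, Prod.snd_sum, Finset.sum_apply, Pi.single_apply]

lemma sum_smul_delX (N : E n → Fin n → Fin n → ℝ) (b : Fin n → ℝ) (p : E n) :
    ∑ r, b r • delX N r p = (0, b, fun k => -∑ r, b r * N p r k) := by
  refine Prod.ext ?_ (Prod.ext ?_ ?_)
  · simp [delX, Prod.fst_sum]
  · funext k
    simp [delX, Prod.fst_sum, Prod.snd_sum, Finset.sum_apply, Pi.single_apply]
  · funext k
    simp [delX, Prod.snd_sum, Finset.sum_apply]

/-- `T(∂/∂y^j, δ/δx^i) = Σ_r C^r_{ij}·δ/δx^r + Σ_r (∂N^r_i/∂y^j − Lv^r_{ji})·∂/∂y^r`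
and `T(∂/∂y^j, ∂/∂y^i) = Σ_r (Cv^r_{ij} − Cv^r_{ji})·∂/∂y^r`. -/
theorem torsion_delY_delX_delY (n : ℕ) (M : E n → Fin n → ℝ) (N : E n → Fin n → Fin n → ℝ)
    (hM : ContDiff ℝ (⊤ : ℕ∞) M) (hN : ContDiff ℝ (⊤ : ℕ∞) N) (K : Conn n) (hK : K.Smooth) (i j : Fin n) :
    (torsion M N K (frY j) (frX i) = fun p =>
      (∑ r, K.C p r i j • delX N r p) +
        ∑ r, (pY (fun q => N q i r) j p - K.Lv p r j i) • delY r p) ∧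
    (torsion M N K (frY j) (frY i) = fun p =>
      ∑ r, (K.Cv p r i j - K.Cv p r j i) • delY r p) := by
  have hN' : Differentiable ℝ N := hN.differentiable (by simp)
  refine ⟨funext fun p => ?_, funext fun p => ?_⟩
  · rw [sum_smul_delX, sum_smul_delY, torsion, nabla_frY_frX, nabla_frX_frY, realize_frX,
      realize_frY, lieBr_delY_delX hN']
    refine Prod.ext ?_ (Prod.ext ?_ ?_)
    · simp [DVF.realize]
    · funext k
      simp [DVF.realize]
    · funext k
      simp [DVF.realize]
      ring
  · rw [sum_smul_delY, torsion, nabla_frY_frY, nabla_frY_frY, realize_frY, realize_frY,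
      lieBr_delY_delY]
    refine Prod.ext ?_ (Prod.ext ?_ ?_)
    · simp [DVF.realize]
    · funext k
      simp [DVF.realize]
    · funext k
      simp [DVF.realize]
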